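/- arXiv:0911.4751 — 2 statements merged into one kernel-verified Lean document; each statement's English description precedes it below -/
import Mathlib

section
/- If x* ∈ Δ^7 satisfies F†(x*) = α†, then there exist two distinct indices j_1, j_2 ∈ {1,…,8} with j_1 ≠ j_2 such that f_{j_1}(x*) = f_{j_2}(x*) = α†; that is, at a minimizer of F† at least two of the eight functions attain the value α†. -/
noncomputable def sigD (t : ℝ) : ℝ := (1 - t) / t

def DeltaSeven : Set (Fin 8 → ℝ) := {x | (∀ i, 0 < x i) ∧ ∑ i, x i = 1}

noncomputable def fD (x : Fin 8 → ℝ) : Fin 8 → ℝ :=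
  ![sigD (x 3 + x 4 + x 5) * sigD (x 0),
    sigD (x 3 + x 4 + x 5 + x 6 + x 7) * sigD (x 1),
    sigD (x 0 + x 1 + x 2 + x 6 + x 7) * sigD (x 2),
    sigD (x 0 + x 1 + x 2) * sigD (x 3),
    sigD (x 0 + x 1 + x 2 + x 6 + x 7) * sigD (x 4),
    sigD (x 3 + x 4 + x 5 + x 6 + x 7) * sigD (x 5),
    sigD (x 3 + x 4 + x 5) * sigD (x 6),
    sigD (x 0 + x 1 + x 2) * sigD (x 7)]

noncomputable def FD (x : Fin 8 → ℝ) : ℝ :=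
  Finset.univ.sup' Finset.univ_nonempty (fD x)

noncomputable def alphaD : ℝ := sInf (FD '' DeltaSeven)

theorem sigD_pos {t : ℝ} (h0 : 0 < t) (h1 : t < 1) : 0 < sigD t :=
  div_pos (by linarith) h0

theorem sigD_anti {s t : ℝ} (h0 : 0 < s) (h1 : s < t) : sigD t < sigD s := by
  have ht : 0 < t := h0.trans h1
  unfold sigD
  rw [div_lt_div_iff₀ ht h0]
  nlinarith

theorem sigD_contAt {t : ℝ} (h0 : 0 < t) : ContinuousAt sigD t := by
  unfold sigD
  exact (continuousAt_const.sub continuousAt_id).div continuousAt_id h0.ne'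

def dirD : Fin 8 → Fin 8 → ℝ :=
  ![![1, -1, 0, 0, 0, 0, 0, 0], ![-1, 1, 0, 0, 0, 0, 0, 0], ![0, -1, 1, 0, 0, 0, 0, 0],
    ![0, 0, 0, 1, -1, 0, 0, 0], ![0, 0, 0, -1, 1, 0, 0, 0], ![0, 0, 0, -1, 0, 1, 0, 0],
    ![0, 0, 0, 0, 0, 0, 1, -1], ![0, 0, 0, 0, 0, 0, -1, 1]]

def moveD (x : Fin 8 → ℝ) (j : Fin 8) (e : ℝ) : Fin 8 → ℝ := fun i => x i + e * dirD j i

theorem fD_cont (x : Fin 8 → ℝ) (hx : x ∈ DeltaSeven) (i : Fin 8) :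
    ContinuousAt (fun y => fD y i) x := by
  obtain ⟨hp, -⟩ := hx
  have h0 := hp 0
  have h1 := hp 1
  have h2 := hp 2
  have h3 := hp 3
  have h4 := hp 4
  have h5 := hp 5
  have h6 := hp 6
  have h7 := hp 7
  have key : ∀ (g : (Fin 8 → ℝ) → ℝ), Continuous g → 0 < g x →
      ContinuousAt (fun y => sigD (g y)) x := fun g hg hpos =>
    ContinuousAt.comp (f := g) (sigD_contAt hpos) hg.continuousAt
  fin_cases i <;> simp [fD] <;>
    exact (key _ (by fun_prop) (by positivity)).mul (key _ (by fun_prop) (by positivity))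

theorem fD_pos (x : Fin 8 → ℝ) (hx : x ∈ DeltaSeven) : 0 < fD x 0 := by
  obtain ⟨hp, hs⟩ := hx
  rw [Fin.sum_univ_eight] at hs
  have h0 := hp 0
  have h1 := hp 1
  have h2 := hp 2
  have h3 := hp 3
  have h4 := hp 4
  have h5 := hp 5
  have h6 := hp 6
  have h7 := hp 7
  simp only [fD, Matrix.cons_val_zero]
  exact mul_pos (sigD_pos (by linarith) (by linarith)) (sigD_pos (by linarith) (by linarith))

theorem fD_move (x : Fin 8 → ℝ) (hx : x ∈ DeltaSeven) (j : Fin 8) (e : ℝ) (he : 0 < e) :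
    fD (moveD x j e) j < fD x j := by
  obtain ⟨hp, hs⟩ := hx
  rw [Fin.sum_univ_eight] at hs
  have h0 := hp 0
  have h1 := hp 1
  have h2 := hp 2
  have h3 := hp 3
  have h4 := hp 4
  have h5 := hp 5
  have h6 := hp 6
  have h7 := hp 7
  have key : ∀ S S' a a' : ℝ, S' = S → 0 < S → S < 1 → 0 < a → a < a' →
      sigD S' * sigD a' < sigD S * sigD a := by
    intro S S' a a' h hS hS1 ha haa
    subst h
    exact mul_lt_mul_of_pos_left (sigD_anti ha haa) (sigD_pos hS hS1)
  fin_cases j <;> simp [fD, moveD, dirD] <;>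
    exact key _ _ _ _ (by ring) (by linarith) (by linarith) (by linarith) (by linarith)

theorem moveD_sum (x : Fin 8 → ℝ) (j : Fin 8) (e : ℝ) : ∑ i, moveD x j e i = ∑ i, x i := by
  rw [Fin.sum_univ_eight, Fin.sum_univ_eight]
  fin_cases j <;> simp [moveD, dirD] <;> ring

open Filter Topology in
theorem stmt6 (x : Fin 8 → ℝ) (hx : x ∈ DeltaSeven) (hmin : FD x = alphaD) :
    ∃ j1 j2 : Fin 8, j1 ≠ j2 ∧ fD x j1 = alphaD ∧ fD x j2 = alphaD := by
  obtain ⟨j, -, hj⟩ := Finset.exists_mem_eq_sup' Finset.univ_nonempty (fD x)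
  have hjα : fD x j = alphaD := by rw [← hmin]; exact hj.symm
  by_contra hcon
  have hlt : ∀ i, i ≠ j → fD x i < alphaD := by
    intro i hi
    refine lt_of_le_of_ne ?_ fun h => hcon ⟨i, j, hi, h, hjα⟩
    rw [← hmin]
    exact Finset.le_sup' (fD x) (Finset.mem_univ i)
  have hm0 : moveD x j 0 = x := by funext i; simp [moveD]
  have hmc : Continuous (moveD x j) := by unfold moveD; fun_prop
  have hpos : ∀ᶠ e in 𝓝 (0 : ℝ), ∀ i, 0 < moveD x j e i := by
    rw [eventually_all]
    intro i
    have hc : ContinuousAt (fun e => moveD x j e i) 0 := by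
      unfold moveD; fun_prop
    refine continuousAt_const.eventually_lt hc ?_
    rw [hm0]
    exact hx.1 i
  have hoth : ∀ᶠ e in 𝓝 (0 : ℝ), ∀ i, i ≠ j → fD (moveD x j e) i < alphaD := by
    rw [eventually_all]
    intro i
    by_cases hi : i = j
    · exact Eventually.of_forall fun e h => absurd hi h
    have hc : ContinuousAt (fun e => fD (moveD x j e) i) 0 :=
      ContinuousAt.comp (f := moveD x j) (g := fun y => fD y i)
        (by rw [hm0]; exact fD_cont x hx i) hmc.continuousAt
    have := hc.eventually_lt (continuousAt_const (y := alphaD)) (by rw [hm0]; exact hlt i hi)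
    exact this.mono fun e h _ => h
  have hall := ((hpos.and hoth).filter_mono (nhdsWithin_le_nhds (s := Set.Ioi 0))).and
    self_mem_nhdsWithin
  obtain ⟨e, ⟨hp, ho⟩, he⟩ := hall.exists
  have hy : moveD x j e ∈ DeltaSeven := ⟨hp, by rw [moveD_sum]; exact hx.2⟩
  have hF : FD (moveD x j e) < alphaD := by
    unfold FD
    rw [Finset.sup'_lt_iff]
    intro i _
    by_cases hi : i = j
    · subst hi
      rw [← hjα]
      exact fD_move x hx i e he
    · exact ho i hi
  have hbdd : BddBelow (FD '' DeltaSeven) := by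
    refine ⟨0, ?_⟩
    rintro _ ⟨z, hz, rfl⟩
    exact (fD_pos z hz).le.trans (Finset.le_sup' (fD z) (Finset.mem_univ 0))
  exact absurd (csInf_le hbdd ⟨_, hy, rfl⟩) (not_le.mpr hF)
end

section
/- The infimum of F† over Δ^7 equals 5+3√2; that is, inf_{x ∈ Δ^7} max_{1≤i≤8} f_i(x) = 5+3√2, and this infimum is attained. -/
/-- Minimal value of `x` allowed by `σ(T) σ(x) < 5 + 3 s`. -/
noncomputable def rD (s T : ℝ) : ℝ := (1 - T) / ((5 + 3 * s) * T + (1 - T))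

theorem rD_lt (s T x : ℝ) (hs : 0 < s) (hT : 0 < T) (hT1 : T < 1) (hx : 0 < x)
    (h : sigD T * sigD x < 5 + 3 * s) : rD s T < x := by
  unfold sigD at h
  unfold rD
  have hd : 0 < (5 + 3 * s) * T + (1 - T) := by
    have := mul_pos (show 0 < 5 + 3 * s by linarith) hT
    linarith
  rw [div_mul_div_comm, div_lt_iff₀ (mul_pos hT hx)] at h
  rw [div_lt_iff₀ hd]
  nlinarith

theorem phi_le (s A : ℝ) (hs : 0 < s) (h2 : s ^ 2 = 2) (hA : 0 < A) (hA1 : A < 1) :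
    2 * (A - rD s A - 2 * rD s (1 - A)) + (5 + 6 * s) * (1 / 2 - A - rD s A) ≤ 0 := by
  have hB : 0 < 1 - A := by linarith
  have h1 : 0 < (5 + 3 * s) * A + (1 - A) := by positivity
  have h3 : 0 < (5 + 3 * s) * (1 - A) + A := by positivity
  have key : 2 * (A - rD s A - 2 * rD s (1 - A)) + (5 + 6 * s) * (1 / 2 - A - rD s A)
      = - ((3 * (5 + 3 * s) / 2) * ((1 - A - (1 + s) * A) ^ 2 * ((3 + 2 * s) * (1 - A) + A))
        / (((5 + 3 * s) * A + (1 - A)) * ((5 + 3 * s) * (1 - A) + A))) := by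
    have e : rD s (1 - A) = A / ((5 + 3 * s) * (1 - A) + A) := by
      unfold rD; congr 1 <;> ring
    rw [e]; unfold rD
    have h1' := h1.ne'
    have h3' := h3.ne'
    generalize hP : (5 + 3 * s) * A + (1 - A) = P at *
    generalize hQ : (5 + 3 * s) * (1 - A) + A = Q at *
    field_simp
    subst hP hQ
    have h4 : s ^ 3 = 2 * s := by rw [pow_succ, h2]
    have h5 : s ^ 4 = 4 := by rw [show s ^ 4 = (s ^ 2) ^ 2 by ring, h2]; norm_num
    ring_nf
    simp only [h2, h4, h5]
    ring
  rw [key, neg_nonpos]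
  positivity

theorem FD_ge (x : Fin 8 → ℝ) (hx : x ∈ DeltaSeven) : 5 + 3 * Real.sqrt 2 ≤ FD x := by
  by_contra hlt
  push Not at hlt
  have hs : 0 < Real.sqrt 2 := by positivity
  have h2 : Real.sqrt 2 ^ 2 = 2 := Real.sq_sqrt (by norm_num)
  generalize Real.sqrt 2 = s at *
  obtain ⟨hp, hsum⟩ := hx
  have hf : ∀ i, fD x i < 5 + 3 * s := fun i =>
    lt_of_le_of_lt (Finset.le_sup' (fD x) (Finset.mem_univ i)) hlt
  simp only [Fin.sum_univ_eight] at hsum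
  have p0 := hp 0
  have p1 := hp 1
  have p2 := hp 2
  have p3 := hp 3
  have p4 := hp 4
  have p5 := hp 5
  have p6 := hp 6
  have p7 := hp 7
  have eA : x 3 + x 4 + x 5 + x 6 + x 7 = 1 - (x 0 + x 1 + x 2) := by linarith
  have eB : x 0 + x 1 + x 2 + x 6 + x 7 = 1 - (x 3 + x 4 + x 5) := by linarith
  have g0 := rD_lt s _ _ hs (by linarith) (by linarith) p0 (hf 0)
  have g1 := rD_lt s _ _ hs (by linarith) (by linarith) p1 (hf 1)
  have g2 := rD_lt s _ _ hs (by linarith) (by linarith) p2 (hf 2)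
  have g3 := rD_lt s _ _ hs (by linarith) (by linarith) p3 (hf 3)
  have g4 := rD_lt s _ _ hs (by linarith) (by linarith) p4 (hf 4)
  have g5 := rD_lt s _ _ hs (by linarith) (by linarith) p5 (hf 5)
  have g6 := rD_lt s _ _ hs (by linarith) (by linarith) p6 (hf 6)
  have g7 := rD_lt s _ _ hs (by linarith) (by linarith) p7 (hf 7)
  rw [eA] at g1 g5
  rw [eB] at g2 g4
  have qA := phi_le s (x 0 + x 1 + x 2) hs h2 (by linarith) (by linarith)
  have qB := phi_le s (x 3 + x 4 + x 5) hs h2 (by linarith) (by linarith)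
  generalize hA : x 0 + x 1 + x 2 = A at *
  generalize hB : x 3 + x 4 + x 5 = B at *
  have c : 0 < (1 / 2 - A - rD s A) + (1 / 2 - B - rD s B) := by linarith
  have d : 0 < (A - rD s A - 2 * rD s (1 - A)) + (B - rD s B - 2 * rD s (1 - B)) := by linarith
  have := mul_pos (show 0 < 5 + 6 * s by linarith) c
  linarith

theorem sig_eq (s T x : ℝ) (hT : 0 < T) (hx : 0 < x)
    (h : (1 - T) * (1 - x) = (5 + 3 * s) * (T * x)) : sigD T * sigD x = 5 + 3 * s := by
  unfold sigD
  rw [div_mul_div_comm, div_eq_iff (mul_pos hT hx).ne', h]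

theorem FD_attained : ∃ x ∈ DeltaSeven, FD x = 5 + 3 * Real.sqrt 2 := by
  have h2 : Real.sqrt 2 ^ 2 = 2 := Real.sq_sqrt (by norm_num)
  have hs : 1.4 < Real.sqrt 2 := Real.lt_sqrt_of_sq_lt (by norm_num)
  have hs' : Real.sqrt 2 < 1.42 := by
    rw [Real.sqrt_lt' (by norm_num)]; norm_num
  generalize Real.sqrt 2 = s at *
  have h4 : s ^ 3 = 2 * s := by rw [pow_succ, h2]
  refine ⟨![(s-1)/2, (3-2*s)/4, (3-2*s)/4, (s-1)/2, (3-2*s)/4, (3-2*s)/4, (s-1)/2, (s-1)/2],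
    ⟨?_, ?_⟩, ?_⟩
  · intro i
    fin_cases i <;> simp <;> linarith
  · simp [Fin.sum_univ_eight]; ring
  · have hf : ∀ i, fD ![(s-1)/2, (3-2*s)/4, (3-2*s)/4, (s-1)/2, (3-2*s)/4, (3-2*s)/4,
        (s-1)/2, (s-1)/2] i = 5 + 3 * s := by
      intro i
      fin_cases i <;> simp [fD] <;> apply sig_eq <;>
        first
        | linarith
        | (ring_nf; simp only [h2, h4]; ring)
    unfold FD
    rw [Finset.sup'_congr _ rfl (fun i _ => hf i)]
    exact Finset.sup'_const _ _

theorem stmt14 :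
    sInf (FD '' DeltaSeven) = 5 + 3 * Real.sqrt 2 ∧
    ∃ x ∈ DeltaSeven, FD x = 5 + 3 * Real.sqrt 2 := by
  obtain ⟨x, hx, hv⟩ := FD_attained
  refine ⟨?_, x, hx, hv⟩
  apply IsLeast.csInf_eq
  refine ⟨⟨x, hx, hv⟩, ?_⟩
  rintro _ ⟨y, hy, rfl⟩
  exact FD_ge y hy
end
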